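/- arXiv:2201.02258 — 10 statements merged into one kernel-verified Lean document; each statement's English description precedes it below -/
import Mathlib

section
/- Let D : ℝ³ → ℝ³ be a linear map that is a derivation of the Heisenberg Lie bracket (i.e. D[X,Y] = [DX,Y] + [X,DY] for all X, Y ∈ ℝ³) and is skew-symmetric with respect to the standard Euclidean inner product (⟨DX,Y⟩ + ⟨X,DY⟩ = 0 for all X, Y). Then there exists b ∈ ℝ such that D(x,y,z) = (−b·y, b·x, 0) for all (x,y,z) ∈ ℝ³. -/
/-- Every linear map `D : ℝ³ → ℝ³` which is a derivation of the Heisenberg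
bracket `[(x,y,z),(x',y',z')] = (0,0, x y' - y x')` and is skew-symmetric with respect to
the standard Euclidean inner product is of the form `D(x,y,z) = (-b y, b x, 0)` for some
`b ∈ ℝ`. -/
theorem stmt_3
    (D : (Fin 3 → ℝ) →ₗ[ℝ] (Fin 3 → ℝ))
    (bracket : (Fin 3 → ℝ) → (Fin 3 → ℝ) → (Fin 3 → ℝ))
    (hbracket : ∀ X Y, bracket X Y = ![0, 0, X 0 * Y 1 - X 1 * Y 0])
    (hder : ∀ X Y, D (bracket X Y) = bracket (D X) Y + bracket X (D Y))
    (hskew : ∀ X Y : Fin 3 → ℝ,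
      (D X 0 * Y 0 + D X 1 * Y 1 + D X 2 * Y 2) +
      (X 0 * D Y 0 + X 1 * D Y 1 + X 2 * D Y 2) = 0) :
    ∃ b : ℝ, ∀ X : Fin 3 → ℝ, D X = ![-b * X 1, b * X 0, 0] := by
  have h3 := hder ![1, 0, 0] ![0, 1, 0]
  simp only [hbracket] at h3
  have h30 := congrFun h3 0
  have h31 := congrFun h3 1
  have s0 := fun X => hskew X ![1, 0, 0]
  have s1 := fun X => hskew X ![0, 1, 0]
  have s2 := fun X => hskew X ![0, 0, 1]
  simp at h30 h31 s0 s1 s2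
  have a00 := s0 ![1, 0, 0]
  have a01 := s0 ![0, 1, 0]
  have a02 := s0 ![0, 0, 1]
  have a11 := s1 ![0, 1, 0]
  have a12 := s1 ![0, 0, 1]
  have a22 := s2 ![0, 0, 1]
  simp at a00 a01 a02 a11 a12 a22
  have b02 : D ![1, 0, 0] 2 = 0 := by linarith
  have b12 : D ![0, 1, 0] 2 = 0 := by linarith
  have b10 : D ![0, 1, 0] 0 = - D ![1, 0, 0] 1 := by linarith
  have b22 : D ![0, 0, 1] 2 = 0 := by linarith
  have b00 : D ![1, 0, 0] 0 = 0 := by linarith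
  have b11 : D ![0, 1, 0] 1 = 0 := by linarith
  refine ⟨D ![1, 0, 0] 1, fun X => ?_⟩
  have c0 := s0 X
  have c1 := s1 X
  have c2 := s2 X
  rw [b00, b02] at c0
  rw [b10, b11, b12] at c1
  rw [h30, h31, b22] at c2
  ext i
  fin_cases i
  · simp; linarith
  · simp; linarith
  · simp; linarith
end

section
/- Let n be a finite-dimensional real 2-step nilpotent Lie algebra with an inner product, center z, v = z^⊥, commutator ideal C(n) = [n,n], and maps j(Z) as in the context. Let F : n → n be a skew-symmetric linear map with F(z) ⊆ z and F(v) ⊆ v, and suppose the associated left-invariant 2-form is closed, i.e. ⟨F[X,Y], W⟩ + ⟨F[Y,W], X⟩ + ⟨F[W,X], Y⟩ = 0 for all X, Y, W ∈ n. Then F vanishes on C(n), and F(z) ⊆ ker(j) = {Z ∈ z : j(Z) = 0}. -/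
open scoped RealInnerProductSpace

/-- Let `F` be a skew-symmetric linear map on a finite-dimensional real
2-step nilpotent metric Lie algebra preserving the decomposition `n = v ⊕ z`
(`F(z) ⊆ z`, `F(v) ⊆ v`) whose associated left-invariant 2-form is closed (cyclic
condition). Then `F` vanishes on the commutator `C = [n,n]` and `F(z) ⊆ ker j`. -/
theorem stmt_5
    {n : Type*} [NormedAddCommGroup n] [InnerProductSpace ℝ n] [FiniteDimensional ℝ n]
    (B : n →ₗ[ℝ] n →ₗ[ℝ] n)
    (hBskew : ∀ X Y : n, B X Y = - B Y X)
    (hB2step : ∀ X Y W : n, B (B X Y) W = 0)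
    (z : Submodule ℝ n)
    (hz : ∀ Z : n, Z ∈ z ↔ ∀ X : n, B Z X = 0)
    (C : Submodule ℝ n)
    (hC : C = Submodule.span ℝ {X : n | ∃ U V : n, B U V = X})
    (j : n →ₗ[ℝ] n →ₗ[ℝ] n)
    (hj : ∀ Z ∈ z, ∀ V ∈ zᗮ, ∀ W ∈ zᗮ, ⟪j Z V, W⟫ = ⟪Z, B V W⟫)
    (hjv : ∀ Z : n, ∀ V ∈ zᗮ, j Z V ∈ zᗮ)
    (hjz : ∀ Z : n, ∀ X ∈ z, j Z X = 0)
    (F : n →ₗ[ℝ] n)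
    (hFskew : ∀ X Y : n, ⟪F X, Y⟫ = -(⟪X, F Y⟫ : ℝ))
    (hFz : ∀ Z ∈ z, F Z ∈ z)
    (hFv : ∀ V ∈ zᗮ, F V ∈ zᗮ)
    (hclosed : ∀ X Y W : n,
      (⟪F (B X Y), W⟫ : ℝ) + ⟪F (B Y W), X⟫ + ⟪F (B W X), Y⟫ = 0) :
    (∀ W ∈ C, F W = 0) ∧ (∀ Z ∈ z, F Z ∈ z ⊓ LinearMap.ker j) := by
  have hF : ∀ X Y : n, F (B X Y) = 0 := by
    intro X Y
    have h1 : F (B X Y) ∈ z := hFz _ ((hz _).2 (hB2step X Y))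
    have h2 := (hz _).1 h1
    have h3 := hclosed X Y (F (B X Y))
    rw [hBskew Y (F (B X Y)), h2 Y, h2 X] at h3
    simpa using h3
  refine ⟨?_, ?_⟩
  · intro W hW
    rw [hC] at hW
    have hle : Submodule.span ℝ {X : n | ∃ U V : n, B U V = X} ≤ LinearMap.ker F := by
      rw [Submodule.span_le]
      rintro _ ⟨U, V, rfl⟩
      exact hF U V
    exact hle hW
  · intro Z hZ
    refine ⟨hFz Z hZ, ?_⟩
    rw [SetLike.mem_coe, LinearMap.mem_ker]
    ext X
    obtain ⟨a, ha, b, hb, rfl⟩ := z.exists_add_mem_mem_orthogonal X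
    rw [map_add, hjz _ a ha, zero_add, LinearMap.zero_apply]
    have h := hj (F Z) (hFz Z hZ) b hb _ (hjv (F Z) b hb)
    rw [hFskew, hF, inner_zero_right, neg_zero] at h
    exact inner_self_eq_zero.1 h
end

section
/- Let F : ℝ³ → ℝ³ be a linear map that is skew-symmetric with respect to the standard Euclidean inner product and satisfies F(span{e₁,e₂}) ⊆ span{e₃} and F(e₃) ∈ span{e₁,e₂}. Then there exists U ∈ span{e₁,e₂} such that F(V + Z) = [V, U] + j(Z)U for all V ∈ span{e₁,e₂} and Z ∈ span{e₃}, where the bracket is the Heisenberg bracket and j(c·e₃)(u₁,u₂,0) = (−c·u₂, c·u₁, 0). -/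
/-- A linear map `F : ℝ³ → ℝ³` which is skew-symmetric for the standard
inner product and maps `v = span{e₁,e₂}` into `z = span{e₃}` and `e₃` into `v`
(a Lorentz force of type II on the Heisenberg algebra) is of the form
`F(V+Z) = [V,U] + j(Z)U` for some `U = (u₁,u₂,0) ∈ v`; concretely
`F(v₁,v₂,c) = (-c·u₂, c·u₁, v₁·u₂ - v₂·u₁)`. -/
theorem stmt_10
    (F : (Fin 3 → ℝ) →ₗ[ℝ] (Fin 3 → ℝ))
    (hskew : ∀ X Y : Fin 3 → ℝ,
      F X 0 * Y 0 + F X 1 * Y 1 + F X 2 * Y 2 =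
        -(X 0 * F Y 0 + X 1 * F Y 1 + X 2 * F Y 2))
    (hv : ∀ V : Fin 3 → ℝ, V 2 = 0 → F V 0 = 0 ∧ F V 1 = 0)
    (hz : F ![0, 0, 1] 2 = 0) :
    ∃ u₁ u₂ : ℝ, ∀ v₁ v₂ c : ℝ,
      F ![v₁, v₂, c] = ![-c * u₂, c * u₁, v₁ * u₂ - v₂ * u₁] := by
  have h1 := hv ![1, 0, 0] (by simp)
  have h2 := hv ![0, 1, 0] (by simp)
  have k1 := hskew ![1, 0, 0] ![0, 0, 1]
  have k2 := hskew ![0, 1, 0] ![0, 0, 1]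
  refine ⟨F ![0, 0, 1] 1, -F ![0, 0, 1] 0, fun v₁ v₂ c => ?_⟩
  have m1 := hskew ![v₁, v₂, c] ![1, 0, 0]
  have m2 := hskew ![v₁, v₂, c] ![0, 1, 0]
  have m3 := hskew ![v₁, v₂, c] ![0, 0, 1]
  simp [h1, h2, hz] at k1 k2 m1 m2 m3
  ext i
  fin_cases i
  · simp [m1, k1]
  · simp [m2, k2]
  · simp [m3]; ring
end

section
/- Let z₀, y₀ ∈ ℝ and let x, y : ℝ → ℝ be twice differentiable functions satisfying x''(t) + (x(t)+z₀)·(y'(t)+1) = 0 and y''(t) − (x(t)+z₀)·x'(t) = 0 for all t ∈ ℝ, with x(0) = 0 and y'(0) = y₀. Then for all t ∈ ℝ: y'(t) = x(t)²/2 + z₀·x(t) + y₀, and x satisfies the second-order autonomous equation x''(t) + (x(t)+z₀)·(x(t)²/2 + z₀·x(t) + y₀ + 1) = 0. -/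
/-- For the magnetic system `x'' + (x+z₀)(y'+1) = 0`,
`y'' - (x+z₀)x' = 0` with `x(0) = 0`, `y'(0) = y₀`, one has the first integral
`y' = x²/2 + z₀·x + y₀` and the reduced autonomous equation
`x'' + (x+z₀)(x²/2 + z₀·x + y₀ + 1) = 0`. -/
theorem stmt_11
    (z₀ y₀ : ℝ) (x y x' y' x'' y'' : ℝ → ℝ)
    (hx : ∀ t : ℝ, HasDerivAt x (x' t) t)
    (hx' : ∀ t : ℝ, HasDerivAt x' (x'' t) t)
    (hy : ∀ t : ℝ, HasDerivAt y (y' t) t)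
    (hy' : ∀ t : ℝ, HasDerivAt y' (y'' t) t)
    (heq1 : ∀ t : ℝ, x'' t + (x t + z₀) * (y' t + 1) = 0)
    (heq2 : ∀ t : ℝ, y'' t - (x t + z₀) * x' t = 0)
    (hx0 : x 0 = 0) (hy'0 : y' 0 = y₀) :
    (∀ t : ℝ, y' t = (x t) ^ 2 / 2 + z₀ * x t + y₀) ∧
    (∀ t : ℝ, x'' t + (x t + z₀) * ((x t) ^ 2 / 2 + z₀ * x t + y₀ + 1) = 0) := by
  have key : ∀ t : ℝ, y' t = (x t) ^ 2 / 2 + z₀ * x t + y₀ := by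
    have hd : ∀ t : ℝ, HasDerivAt (fun s => y' s - (x s * x s / 2 + z₀ * x s)) 0 t := by
      intro t
      have h := (hy' t).sub ((((hx t).mul (hx t)).div_const 2).add ((hx t).const_mul z₀))
      refine h.congr_deriv ?_
      linarith [heq2 t]
    intro t
    have hc := is_const_of_deriv_eq_zero (fun s => (hd s).differentiableAt)
      (fun s => (hd s).deriv) t 0
    simp only [hx0, hy'0] at hc
    linarith
  refine ⟨key, fun t => ?_⟩
  rw [← key t]
  exact heq1 t
end

section
/- Let x₀ ≥ 0 and y₁ ∈ ℝ, set v = √(x₀² + y₁²), assume v + y₁ > 0, and set z₀ = √(2(v + y₁)) and C₂ = artanh(√((4v − z₀²)/(4v))), where artanh is the inverse hyperbolic tangent. Define Φ : ℝ → ℝ by Φ(t) = 2√v / cosh(C₂ − √v·t) − z₀. Then Φ(0) = 0, Φ'(0) = x₀, and Φ satisfies Φ''(t) + (Φ(t)+z₀)·(Φ(t)²/2 + z₀·Φ(t) + y₁) = 0 for all t ∈ ℝ. -/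
/-- The inverse hyperbolic tangent, `artanh x = (1/2)·ln((1+x)/(1-x))`. -/
noncomputable def artanh (s : ℝ) : ℝ := (1 / 2) * Real.log ((1 + s) / (1 - s))

/-- In the borderline case `z₀ = √(2(v+y₁))` (with `v = √(x₀²+y₁²)`,
`v + y₁ > 0`, `x₀ ≥ 0`, `C₂ = artanh(√((4v-z₀²)/(4v)))`), the function
`Φ(t) = 2√v·sech(C₂ - √v·t) - z₀` satisfies `Φ(0) = 0`, `Φ'(0) = x₀` and the ODE
`Φ'' + (Φ+z₀)(Φ²/2 + z₀Φ + y₁) = 0`. -/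
theorem stmt_13
    (x₀ y₁ : ℝ) (hx₀ : 0 ≤ x₀)
    (v : ℝ) (hv : v = Real.sqrt (x₀ ^ 2 + y₁ ^ 2)) (hvy : 0 < v + y₁)
    (z₀ : ℝ) (hz₀ : z₀ = Real.sqrt (2 * (v + y₁)))
    (C₂ : ℝ) (hC₂ : C₂ = artanh (Real.sqrt ((4 * v - z₀ ^ 2) / (4 * v))))
    (Φ : ℝ → ℝ)
    (hΦ : ∀ t : ℝ, Φ t = 2 * Real.sqrt v / Real.cosh (C₂ - Real.sqrt v * t) - z₀) :
    Φ 0 = 0 ∧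
    ∃ Φ' Φ'' : ℝ → ℝ,
      (∀ t : ℝ, HasDerivAt Φ (Φ' t) t) ∧ (∀ t : ℝ, HasDerivAt Φ' (Φ'' t) t) ∧
      Φ' 0 = x₀ ∧
      (∀ t : ℝ, Φ'' t + (Φ t + z₀) * ((Φ t) ^ 2 / 2 + z₀ * Φ t + y₁) = 0) := by
  have hv0 : 0 ≤ v := hv ▸ Real.sqrt_nonneg _
  have hv2 : v ^ 2 = x₀ ^ 2 + y₁ ^ 2 := by rw [hv]; exact Real.sq_sqrt (by positivity)
  have hyv : y₁ ≤ v := by nlinarith [abs_le_of_sq_le_sq' (by nlinarith [sq_nonneg x₀] : y₁ ^ 2 ≤ v ^ 2) hv0]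
  have hvp : 0 < v := by linarith
  have hz2 : z₀ ^ 2 = 2 * (v + y₁) := by rw [hz₀]; exact Real.sq_sqrt (by positivity)
  have hzp : 0 < z₀ := by rw [hz₀]; exact Real.sqrt_pos.mpr (by positivity)
  obtain ⟨w, hw⟩ : ∃ w, w = Real.sqrt v := ⟨_, rfl⟩
  have hw2 : w ^ 2 = v := by rw [hw]; exact Real.sq_sqrt hv0
  have hwp : 0 < w := by rw [hw]; exact Real.sqrt_pos.mpr hvp
  obtain ⟨r, hr⟩ : ∃ r, r = Real.sqrt ((4 * v - z₀ ^ 2) / (4 * v)) := ⟨_, rfl⟩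
  have hr0 : 0 ≤ r := hr ▸ Real.sqrt_nonneg _
  have hr2 : r ^ 2 = (4 * v - z₀ ^ 2) / (4 * v) := by
    rw [hr]; exact Real.sq_sqrt (div_nonneg (by linarith) (by linarith))
  have hr2' : 1 - r ^ 2 = (z₀ / (2 * w)) ^ 2 := by
    rw [hr2, div_pow, mul_pow, hw2]; field_simp; ring
  have hr1 : r < 1 := by
    have : 0 < (z₀ / (2 * w)) ^ 2 := by positivity
    nlinarith
  have hrI : r ∈ Set.Ioo (-1 : ℝ) 1 := ⟨by linarith, hr1⟩
  have hC : C₂ = Real.artanh r := by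
    rw [hC₂, ← hr, Real.artanh_eq_half_log ⟨by linarith, hr1.le⟩, artanh]
  have hsq : Real.sqrt (1 - r ^ 2) = z₀ / (2 * w) := by
    rw [hr2']; exact Real.sqrt_sq (by positivity)
  have hcosh : Real.cosh C₂ = 2 * w / z₀ := by
    rw [hC, Real.cosh_artanh hrI, hsq]; field_simp
  have hsinh : Real.sinh C₂ = r * (2 * w / z₀) := by
    rw [hC, Real.sinh_artanh hrI, hsq]; field_simp
  rw [← hw] at hΦ
  have hΦe : Φ = fun t => 2 * w / Real.cosh (C₂ - w * t) - z₀ := funext hΦ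
  have hl : ∀ t : ℝ, HasDerivAt (fun t : ℝ => C₂ - w * t) (-w) t := fun t => by
    simpa using ((hasDerivAt_id t).const_mul w).const_sub C₂
  refine ⟨?_, fun t => 2 * v * Real.sinh (C₂ - w * t) / Real.cosh (C₂ - w * t) ^ 2,
    fun t => v * (2 * w / Real.cosh (C₂ - w * t)) - (2 * w / Real.cosh (C₂ - w * t)) ^ 3 / 2,
    ?_, ?_, ?_, ?_⟩
  · rw [hΦ, mul_zero, sub_zero, hcosh]; field_simp; ring
  · intro t
    rw [hΦe]
    have hc := Real.cosh_pos (C₂ - w * t)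
    refine HasDerivAt.congr_deriv (((hasDerivAt_const t (2 * w)).div (hl t).cosh hc.ne').sub_const z₀) ?_
    rw [← hw2]; ring
  · intro t
    have hc := Real.cosh_pos (C₂ - w * t)
    have hs := Real.sinh_sq (C₂ - w * t)
    refine HasDerivAt.congr_deriv
      (((hl t).sinh.const_mul (2 * v)).div ((hl t).cosh.pow 2) (pow_ne_zero 2 hc.ne')) ?_
    simp only [Pi.pow_apply]
    rw [← hw2]
    field_simp
    push_cast
    ring_nf
    rw [hs]
    ring
  · simp only [mul_zero, sub_zero]
    rw [hcosh, hsinh]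
    have h1 : 2 * v * (r * (2 * w / z₀)) / (2 * w / z₀) ^ 2 = w * r * z₀ := by
      rw [← hw2]; field_simp
    rw [h1]
    have h2 : (w * r * z₀) ^ 2 = x₀ ^ 2 := by
      rw [mul_pow, mul_pow, hw2, hr2, hz2]; field_simp; linear_combination 4 * hv2
    exact (sq_eq_sq₀ (by positivity) hx₀).mp h2
  · intro t
    rw [hΦ]
    beta_reduce
    generalize 2 * w / Real.cosh (C₂ - w * t) = u
    linear_combination (-u / 2) * hz2
end

section
/- Let x₀ ≥ 0 and y₁ ∈ ℝ, set v = √(x₀² + y₁²), assume v + y₁ > 0, and set z₀ = −√(2(v + y₁)) and C₂ = artanh(√((4v − z₀²)/(4v))), where artanh is the inverse hyperbolic tangent. Define Φ : ℝ → ℝ by Φ(t) = −2√v / cosh(√v·t − C₂) − z₀. Then Φ(0) = 0, Φ'(0)² = v² − y₁² = x₀², and Φ satisfies Φ''(t) + (Φ(t)+z₀)·(Φ(t)²/2 + z₀·Φ(t) + y₁) = 0 for all t ∈ ℝ. -/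
/-- In the borderline case `z₀ = -√(2(v+y₁))` (with `v = √(x₀²+y₁²)`,
`v + y₁ > 0`, `x₀ ≥ 0`, `C₂ = artanh(√((4v-z₀²)/(4v)))`), the function
`Φ(t) = -2√v·sech(√v·t - C₂) - z₀` satisfies `Φ(0) = 0`, `Φ'(0)² = v² - y₁² = x₀²`
and the ODE `Φ'' + (Φ+z₀)(Φ²/2 + z₀Φ + y₁) = 0`. -/
theorem stmt_14
    (x₀ y₁ : ℝ) (hx₀ : 0 ≤ x₀)
    (v : ℝ) (hv : v = Real.sqrt (x₀ ^ 2 + y₁ ^ 2)) (hvy : 0 < v + y₁)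
    (z₀ : ℝ) (hz₀ : z₀ = -Real.sqrt (2 * (v + y₁)))
    (C₂ : ℝ) (hC₂ : C₂ = artanh (Real.sqrt ((4 * v - z₀ ^ 2) / (4 * v))))
    (Φ : ℝ → ℝ)
    (hΦ : ∀ t : ℝ, Φ t = -(2 * Real.sqrt v) / Real.cosh (Real.sqrt v * t - C₂) - z₀) :
    Φ 0 = 0 ∧
    ∃ Φ' Φ'' : ℝ → ℝ,
      (∀ t : ℝ, HasDerivAt Φ (Φ' t) t) ∧ (∀ t : ℝ, HasDerivAt Φ' (Φ'' t) t) ∧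
      (Φ' 0) ^ 2 = v ^ 2 - y₁ ^ 2 ∧ v ^ 2 - y₁ ^ 2 = x₀ ^ 2 ∧
      (∀ t : ℝ, Φ'' t + (Φ t + z₀) * ((Φ t) ^ 2 / 2 + z₀ * Φ t + y₁) = 0) := by
  have hv0 : 0 ≤ v := hv ▸ Real.sqrt_nonneg _
  have hv2 : v ^ 2 = x₀ ^ 2 + y₁ ^ 2 := by
    rw [hv, Real.sq_sqrt (by positivity)]
  have hvpos : 0 < v := by nlinarith [sq_nonneg x₀]
  have hyv : y₁ ≤ v := by nlinarith [sq_nonneg x₀]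
  have hz2 : z₀ ^ 2 = 2 * (v + y₁) := by
    rw [hz₀, neg_sq, Real.sq_sqrt (by linarith)]
  have hzneg : z₀ < 0 := by
    rw [hz₀]
    have : 0 < Real.sqrt (2 * (v + y₁)) := Real.sqrt_pos.mpr (by linarith)
    linarith
  obtain ⟨w, hw⟩ : ∃ w, w = Real.sqrt v := ⟨_, rfl⟩
  rw [← hw] at hΦ
  have hwpos : 0 < w := hw ▸ Real.sqrt_pos.mpr hvpos
  have hw2 : w ^ 2 = v := by rw [hw, Real.sq_sqrt hv0]
  have hc : Real.cosh C₂ = 2 * w / (-z₀) := by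
    obtain ⟨s, hs⟩ : ∃ s, s = Real.sqrt ((4 * v - z₀ ^ 2) / (4 * v)) := ⟨_, rfl⟩
    have hs0 : 0 ≤ s := hs ▸ Real.sqrt_nonneg _
    have hs2 : s ^ 2 = (4 * v - z₀ ^ 2) / (4 * v) := by
      rw [hs, Real.sq_sqrt]
      apply div_nonneg <;> linarith
    have h1 : 1 - s ^ 2 = ((-z₀) / (2 * w)) ^ 2 := by
      rw [hs2, ← hw2]
      field_simp
      ring
    have hq : 0 < (-z₀) / (2 * w) := div_pos (by linarith) (by linarith)
    have hs1 : s < 1 := by nlinarith [sq_pos_of_pos hq]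
    have hC : C₂ = Real.artanh s := by
      rw [hC₂, ← hs, Real.artanh_eq_half_log ⟨by linarith, hs1.le⟩]
      rfl
    rw [hC, Real.cosh_artanh ⟨by linarith, hs1⟩, h1, Real.sqrt_sq hq.le, one_div_div]
  have hcosh : ∀ t : ℝ, Real.cosh (w * t - C₂) ≠ 0 := fun t => (Real.cosh_pos _).ne'
  have hθ : ∀ t : ℝ, HasDerivAt (fun t : ℝ => w * t - C₂) w t := fun t => by
    simpa using ((hasDerivAt_id t).const_mul w).sub_const C₂
  have hΦe : Φ = fun t => -(2 * w) / Real.cosh (w * t - C₂) - z₀ := funext hΦ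
  have hzne : z₀ ≠ 0 := hzneg.ne
  refine ⟨?_, fun t => 2 * w ^ 2 * Real.sinh (w * t - C₂) / Real.cosh (w * t - C₂) ^ 2,
    fun t => 2 * w ^ 3 * (2 - Real.cosh (w * t - C₂) ^ 2) / Real.cosh (w * t - C₂) ^ 3,
    ?_, ?_, ?_, by linarith, ?_⟩
  · rw [hΦ, mul_zero, zero_sub, Real.cosh_neg, hc]
    field_simp
    ring
  · intro t
    rw [hΦe]
    have h := (((hasDerivAt_const t (-(2 * w))).div ((hθ t).cosh) (hcosh t))).sub_const z₀
    refine h.congr_deriv ?_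
    ring
  · intro t
    have h := (((hθ t).sinh).const_mul (2 * w ^ 2)).div (((hθ t).cosh).pow 2)
      (pow_ne_zero 2 (hcosh t))
    refine h.congr_deriv ?_
    have h3 := Real.cosh_sq (w * t - C₂)
    have h4 := hcosh t
    have h5 : Real.sinh (w * t - C₂) ^ 2 = Real.cosh (w * t - C₂) ^ 2 - 1 := by linarith
    simp only [Pi.pow_apply]
    field_simp
    push_cast
    ring_nf
    ring_nf at h5
    rw [h5]
    ring
  · simp only [mul_zero, zero_sub, Real.cosh_neg, Real.sinh_neg]
    have h3 := Real.cosh_sq C₂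
    have h5 : Real.sinh C₂ ^ 2 = Real.cosh C₂ ^ 2 - 1 := by linarith
    rw [div_pow, mul_pow, neg_sq, h5, hc]
    have e : (2 * w / -z₀) ^ 2 = 4 * v / (2 * (v + y₁)) := by
      rw [div_pow, neg_sq, hz2, mul_pow, hw2]; norm_num
    rw [e, mul_pow, hw2]
    field_simp
    ring
  · intro t
    have h4 := hcosh t
    have e : (Φ t) ^ 2 / 2 + z₀ * Φ t + y₁ = (Φ t + z₀) ^ 2 / 2 - w ^ 2 := by
      rw [hw2]; linarith
    rw [e, hΦ]
    field_simp
    ring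
end

section
/- Let n be a finite-dimensional real Lie algebra with an inner product, z its center, v = z^⊥. Let F_z : v → z be a linear map, q ∈ ℝ with q ≠ 0, Z₀, Z₁ ∈ z, W₁ ∈ v, and ω ∈ ℝ with ω ≠ 0. Suppose V : ℝ → v and Z : ℝ → z are differentiable curves satisfying, for all t ∈ ℝ: Z'(t) + (1/2)[V'(t), V(t)] = q·F_z(V(t)) + Z₀, together with the λ-periodicity conditions V(t+ω) = W₁ + V(t) and Z(t+ω) = Z₁ + Z(t) + (1/2)[W₁, V(t)]. Then F_z(W₁) = 0. -/
open scoped RealInnerProductSpace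

/-- Lemma on λ-periodic trajectories: On a finite-dimensional real
metric Lie algebra with center `z` and `v = zᗮ`, suppose curves `V : ℝ → v`,
`Z : ℝ → z` satisfy the (integrated) central magnetic equation
`Z' + (1/2)[V',V] = q·F_z(V) + Z₀` for a type II Lorentz force with central component
`F_z : v → z`, `q ≠ 0`, together with the λ-periodicity conditions
`V(t+ω) = W₁ + V(t)` and `Z(t+ω) = Z₁ + Z(t) + (1/2)[W₁,V(t)]` (`ω ≠ 0`).
Then `F_z(W₁) = 0`. -/
theorem stmt_16
    {n : Type*} [NormedAddCommGroup n] [InnerProductSpace ℝ n] [FiniteDimensional ℝ n]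
    (B : n →ₗ[ℝ] n →ₗ[ℝ] n)
    (hBskew : ∀ X Y : n, B X Y = - B Y X)
    (hBjacobi : ∀ X Y W : n, B (B X Y) W + B (B Y W) X + B (B W X) Y = 0)
    (z : Submodule ℝ n)
    (hz : ∀ Z : n, Z ∈ z ↔ ∀ X : n, B Z X = 0)
    (F : n →ₗ[ℝ] n) (hF : ∀ X ∈ zᗮ, F X ∈ z)
    (q : ℝ) (hq : q ≠ 0)
    (Z₀ : n) (hZ₀ : Z₀ ∈ z) (Z₁ : n) (hZ₁ : Z₁ ∈ z)
    (W₁ : n) (hW₁ : W₁ ∈ zᗮ)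
    (ω : ℝ) (hω : ω ≠ 0)
    (V Z V' Z' : ℝ → n)
    (hVv : ∀ t : ℝ, V t ∈ zᗮ) (hZz : ∀ t : ℝ, Z t ∈ z)
    (hV : ∀ t : ℝ, HasDerivAt V (V' t) t)
    (hZ : ∀ t : ℝ, HasDerivAt Z (Z' t) t)
    (hmag : ∀ t : ℝ, Z' t + (1 / 2 : ℝ) • B (V' t) (V t) = q • F (V t) + Z₀)
    (hperV : ∀ t : ℝ, V (t + ω) = W₁ + V t)
    (hperZ : ∀ t : ℝ, Z (t + ω) = Z₁ + Z t + (1 / 2 : ℝ) • B W₁ (V t)) :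
    F W₁ = 0 := by
  have h1 : V' (0 + ω) = V' 0 := by
    have a := (hV (0 + ω)).comp_add_const 0 ω
    have b := (hV 0).const_add W₁
    have e : (fun t => V (t + ω)) = fun t => W₁ + V t := funext hperV
    rw [e] at a
    exact a.unique b
  have h2 : Z' (0 + ω) = Z' 0 + (1 / 2 : ℝ) • B W₁ (V' 0) := by
    have a := (hZ (0 + ω)).comp_add_const 0 ω
    have c : HasDerivAt (fun t => B W₁ (V t)) (B W₁ (V' 0)) 0 :=
      (LinearMap.toContinuousLinearMap (B W₁)).hasFDerivAt.comp_hasDerivAt (0 : ℝ) (hV 0)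
    have b := ((hZ 0).const_add Z₁).add (c.const_smul (1 / 2 : ℝ))
    have e : (fun t => Z (t + ω)) = fun t => Z₁ + Z t + (1 / 2 : ℝ) • B W₁ (V t) :=
      funext hperZ
    rw [e] at a
    exact a.unique b
  have h3 := hmag (0 + ω)
  have h4 := hmag 0
  rw [h1, h2, hperV, map_add, map_add, hBskew W₁ (V' 0)] at h3
  have h5 : q • F W₁ = 0 := by
    have : q • F W₁ = (q • (F W₁ + F (V 0)) + Z₀) - (q • F (V 0) + Z₀) := by
      rw [smul_add]; abel
    rw [this, ← h3, ← h4]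
    module
  exact (smul_eq_zero.mp h5).resolve_left hq
end

section
/- Let z₀, y₀ ∈ ℝ, let ω > 0, and let x, y, z : ℝ → ℝ be differentiable functions such that x is ω-periodic (x(t+ω) = x(t) for all t), y'(t) = x(t)²/2 + z₀·x(t) + y₀ for all t, and z'(t) = (1/2)·(−x'(t)·y(t) + x(t)·(y'(t)+2)) + z₀ for all t. Set y₁ = y(ω) − y(0). Then for all t ∈ ℝ: y(t+ω) = y(t) + y₁, and the function t ↦ z(t+ω) − z(t) + (1/2)·y₁·x(t) is constant on ℝ. -/
/-- For a magnetic trajectory of the type II Lorentz force `F_{e₂}` on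
`H₃` whose first coordinate `x` is `ω`-periodic, the coordinates satisfy the
quasi-periodicity `y(t+ω) = y(t) + y₁` (with `y₁ = y(ω) - y(0)`) and
`t ↦ z(t+ω) - z(t) + (1/2)·y₁·x(t)` is constant. -/
theorem stmt_17
    (z₀ y₀ ω : ℝ) (hω : 0 < ω)
    (x y z x' y' z' : ℝ → ℝ)
    (hx : ∀ t : ℝ, HasDerivAt x (x' t) t)
    (hy : ∀ t : ℝ, HasDerivAt y (y' t) t)
    (hz : ∀ t : ℝ, HasDerivAt z (z' t) t)
    (hper : ∀ t : ℝ, x (t + ω) = x t)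
    (hy' : ∀ t : ℝ, y' t = (x t) ^ 2 / 2 + z₀ * x t + y₀)
    (hz' : ∀ t : ℝ, z' t = (1 / 2) * (-(x' t) * y t + x t * (y' t + 2)) + z₀) :
    (∀ t : ℝ, y (t + ω) = y t + (y ω - y 0)) ∧
    (∀ s t : ℝ, z (s + ω) - z s + (1 / 2) * (y ω - y 0) * x s
      = z (t + ω) - z t + (1 / 2) * (y ω - y 0) * x t) := by
  have hconst : ∀ f : ℝ → ℝ, (∀ t, HasDerivAt f 0 t) → ∀ s t, f s = f t := fun f hf =>
    is_const_of_deriv_eq_zero (fun t => (hf t).differentiableAt) (fun t => (hf t).deriv)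
  have hxp : ∀ t, x' (t + ω) = x' t := by
    intro t
    have h1 := (hx (t + ω)).comp_add_const t ω
    have h2 : (fun t => x (t + ω)) = x := funext hper
    rw [h2] at h1
    exact h1.unique (hx t)
  have hyp : ∀ t, y' (t + ω) = y' t := by
    intro t
    rw [hy', hy', hper]
  have hY : ∀ t : ℝ, y (t + ω) = y t + (y ω - y 0) := by
    intro t
    have h := hconst (fun t => y (t + ω) - y t) (fun t => by
      have h1 := ((hy (t + ω)).comp_add_const t ω).sub (hy t)
      rw [hyp, sub_self] at h1
      exact h1) t 0
    simp only [zero_add] at h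
    linarith
  refine ⟨hY, hconst (fun t => z (t + ω) - z t + (1 / 2) * (y ω - y 0) * x t) ?_⟩
  intro t
  have h1 := (((hz (t + ω)).comp_add_const t ω).sub (hz t)).add
    ((hx t).const_mul ((1 / 2) * (y ω - y 0)))
  refine h1.congr_deriv ?_
  rw [hz', hz', hxp, hyp, hper, hY]
  ring
end

section
/- Let c₁, c₂ ∈ ℝ with c₁ ≠ 0 and c₂ ≠ 0, and let a₁, b₁, a₂, b₂, z₀ ∈ ℝ. For i = 1, 2 define u_i(t) = (a_i·sin(c_i t) − b_i·(1 − cos(c_i t)))/c_i and v_i(t) = (a_i·(1 − cos(c_i t)) + b_i·sin(c_i t))/c_i, and define z(t) = (z₀ + (a₁²+b₁²)/(2c₁) + (a₂²+b₂²)/(2c₂))·t − (a₁²+b₁²)/(2c₁²)·sin(c₁ t) − (a₂²+b₂²)/(2c₂²)·sin(c₂ t). Then for i = 1, 2 and all t ∈ ℝ: u_i''(t) = −c_i·v_i'(t), v_i''(t) = c_i·u_i'(t), u_i(0) = v_i(0) = z(0) = 0, u_i'(0) = a_i, v_i'(0) = b_i, z'(0) = z₀, and z'(t) + (1/2)·(u₁'(t)v₁(t)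 − v₁'(t)u₁(t) + u₂'(t)v₂(t) − v₂'(t)u₂(t)) = z₀. -/
theorem helper_sin (c t : ℝ) :
    HasDerivAt (fun t : ℝ => Real.sin (c * t)) (c * Real.cos (c * t)) t := by
  have h := ((hasDerivAt_id' t).const_mul c).sin
  exact h.congr_deriv (by ring)

theorem helper_cos (c t : ℝ) :
    HasDerivAt (fun t : ℝ => Real.cos (c * t)) (-(c * Real.sin (c * t))) t := by
  have h := ((hasDerivAt_id' t).const_mul c).cos
  exact h.congr_deriv (by ring)

theorem helper_u (c a b : ℝ) (hc : c ≠ 0) (t : ℝ) :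
    HasDerivAt (fun t : ℝ => (a * Real.sin (c * t) - b * (1 - Real.cos (c * t))) / c)
      (a * Real.cos (c * t) - b * Real.sin (c * t)) t := by
  have h := (((helper_sin c t).const_mul a).sub
    (((helper_cos c t).const_sub 1).const_mul b)).div_const c
  refine h.congr_deriv ?_
  field_simp
  try ring

theorem helper_v (c a b : ℝ) (hc : c ≠ 0) (t : ℝ) :
    HasDerivAt (fun t : ℝ => (a * (1 - Real.cos (c * t)) + b * Real.sin (c * t)) / c)
      (a * Real.sin (c * t) + b * Real.cos (c * t)) t := by
  have h := ((((helper_cos c t).const_sub 1).const_mul a).add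
    ((helper_sin c t).const_mul b)).div_const c
  refine h.congr_deriv ?_
  field_simp
  try ring

theorem helper_u' (c a b t : ℝ) :
    HasDerivAt (fun t : ℝ => a * Real.cos (c * t) - b * Real.sin (c * t))
      (-c * (a * Real.sin (c * t) + b * Real.cos (c * t))) t := by
  have h := ((helper_cos c t).const_mul a).sub ((helper_sin c t).const_mul b)
  exact h.congr_deriv (by ring)

theorem helper_v' (c a b t : ℝ) :
    HasDerivAt (fun t : ℝ => a * Real.sin (c * t) + b * Real.cos (c * t))
      (c * (a * Real.cos (c * t) - b * Real.sin (c * t))) t := by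
  have h := ((helper_sin c t).const_mul a).add ((helper_cos c t).const_mul b)
  exact h.congr_deriv (by ring)

theorem helper_alg (c a b s k : ℝ) (hc : c ≠ 0) (h : s ^ 2 + k ^ 2 = 1) :
    (a ^ 2 + b ^ 2) / (2 * c) * (1 - k) + (1 / 2) *
      ((a * k - b * s) * ((a * (1 - k) + b * s) / c)
        - (a * s + b * k) * ((a * s - b * (1 - k)) / c)) = 0 := by
  field_simp
  linear_combination (-(a ^ 2 + b ^ 2)) * h

/-- The explicit curves `u_i, v_i, z` (with `c_i ≠ 0`) solve the magnetic
system on the 5-dimensional Heisenberg group in exponential coordinates: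
`u_i'' = -c_i·v_i'`, `v_i'' = c_i·u_i'`, the stated initial conditions, and the central
equation `z' + (1/2)(u₁'v₁ - v₁'u₁ + u₂'v₂ - v₂'u₂) = z₀`. -/
theorem stmt_18
    (c₁ c₂ a₁ b₁ a₂ b₂ z₀ : ℝ) (hc₁ : c₁ ≠ 0) (hc₂ : c₂ ≠ 0)
    (u₁ v₁ u₂ v₂ z : ℝ → ℝ)
    (hu₁ : ∀ t : ℝ, u₁ t = (a₁ * Real.sin (c₁ * t) - b₁ * (1 - Real.cos (c₁ * t))) / c₁)
    (hv₁ : ∀ t : ℝ, v₁ t = (a₁ * (1 - Real.cos (c₁ * t)) + b₁ * Real.sin (c₁ * t)) / c₁)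
    (hu₂ : ∀ t : ℝ, u₂ t = (a₂ * Real.sin (c₂ * t) - b₂ * (1 - Real.cos (c₂ * t))) / c₂)
    (hv₂ : ∀ t : ℝ, v₂ t = (a₂ * (1 - Real.cos (c₂ * t)) + b₂ * Real.sin (c₂ * t)) / c₂)
    (hzdef : ∀ t : ℝ, z t =
      (z₀ + (a₁ ^ 2 + b₁ ^ 2) / (2 * c₁) + (a₂ ^ 2 + b₂ ^ 2) / (2 * c₂)) * t
      - (a₁ ^ 2 + b₁ ^ 2) / (2 * c₁ ^ 2) * Real.sin (c₁ * t)
      - (a₂ ^ 2 + b₂ ^ 2) / (2 * c₂ ^ 2) * Real.sin (c₂ * t)) :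
    ∃ u₁' u₁'' v₁' v₁'' u₂' u₂'' v₂' v₂'' z' : ℝ → ℝ,
      (∀ t : ℝ, HasDerivAt u₁ (u₁' t) t) ∧ (∀ t : ℝ, HasDerivAt u₁' (u₁'' t) t) ∧
      (∀ t : ℝ, HasDerivAt v₁ (v₁' t) t) ∧ (∀ t : ℝ, HasDerivAt v₁' (v₁'' t) t) ∧
      (∀ t : ℝ, HasDerivAt u₂ (u₂' t) t) ∧ (∀ t : ℝ, HasDerivAt u₂' (u₂'' t) t) ∧
      (∀ t : ℝ, HasDerivAt v₂ (v₂' t) t) ∧ (∀ t : ℝ, HasDerivAt v₂' (v₂'' t) t) ∧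
      (∀ t : ℝ, HasDerivAt z (z' t) t) ∧
      (∀ t : ℝ, u₁'' t = -c₁ * v₁' t) ∧ (∀ t : ℝ, v₁'' t = c₁ * u₁' t) ∧
      (∀ t : ℝ, u₂'' t = -c₂ * v₂' t) ∧ (∀ t : ℝ, v₂'' t = c₂ * u₂' t) ∧
      u₁ 0 = 0 ∧ v₁ 0 = 0 ∧ u₂ 0 = 0 ∧ v₂ 0 = 0 ∧ z 0 = 0 ∧
      u₁' 0 = a₁ ∧ v₁' 0 = b₁ ∧ u₂' 0 = a₂ ∧ v₂' 0 = b₂ ∧ z' 0 = z₀ ∧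
      (∀ t : ℝ, z' t + (1 / 2) *
        (u₁' t * v₁ t - v₁' t * u₁ t + u₂' t * v₂ t - v₂' t * u₂ t) = z₀) := by
  obtain rfl : u₁ = _ := funext hu₁
  obtain rfl : v₁ = _ := funext hv₁
  obtain rfl : u₂ = _ := funext hu₂
  obtain rfl : v₂ = _ := funext hv₂
  obtain rfl : z = _ := funext hzdef
  refine ⟨fun t => a₁ * Real.cos (c₁ * t) - b₁ * Real.sin (c₁ * t),
    fun t => -c₁ * (a₁ * Real.sin (c₁ * t) + b₁ * Real.cos (c₁ * t)),
    fun t => a₁ * Real.sin (c₁ * t) + b₁ * Real.cos (c₁ * t),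
    fun t => c₁ * (a₁ * Real.cos (c₁ * t) - b₁ * Real.sin (c₁ * t)),
    fun t => a₂ * Real.cos (c₂ * t) - b₂ * Real.sin (c₂ * t),
    fun t => -c₂ * (a₂ * Real.sin (c₂ * t) + b₂ * Real.cos (c₂ * t)),
    fun t => a₂ * Real.sin (c₂ * t) + b₂ * Real.cos (c₂ * t),
    fun t => c₂ * (a₂ * Real.cos (c₂ * t) - b₂ * Real.sin (c₂ * t)),
    fun t => z₀ + (a₁ ^ 2 + b₁ ^ 2) / (2 * c₁) * (1 - Real.cos (c₁ * t))
      + (a₂ ^ 2 + b₂ ^ 2) / (2 * c₂) * (1 - Real.cos (c₂ * t)),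
    fun t => helper_u c₁ a₁ b₁ hc₁ t, fun t => helper_u' c₁ a₁ b₁ t,
    fun t => helper_v c₁ a₁ b₁ hc₁ t, fun t => helper_v' c₁ a₁ b₁ t,
    fun t => helper_u c₂ a₂ b₂ hc₂ t, fun t => helper_u' c₂ a₂ b₂ t,
    fun t => helper_v c₂ a₂ b₂ hc₂ t, fun t => helper_v' c₂ a₂ b₂ t,
    ?_, fun t => rfl, fun t => rfl, fun t => rfl, fun t => rfl,
    by simp, by simp, by simp, by simp, by simp, by simp, by simp, by simp, by simp, by simp, ?_⟩
  · intro t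
    have h := (((hasDerivAt_id' t).const_mul
      (z₀ + (a₁ ^ 2 + b₁ ^ 2) / (2 * c₁) + (a₂ ^ 2 + b₂ ^ 2) / (2 * c₂))).sub
      ((helper_sin c₁ t).const_mul ((a₁ ^ 2 + b₁ ^ 2) / (2 * c₁ ^ 2)))).sub
      ((helper_sin c₂ t).const_mul ((a₂ ^ 2 + b₂ ^ 2) / (2 * c₂ ^ 2)))
    refine h.congr_deriv ?_
    field_simp
    ring
  · intro t
    have h₁ := helper_alg c₁ a₁ b₁ _ _ hc₁ (Real.sin_sq_add_cos_sq (c₁ * t))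
    have h₂ := helper_alg c₂ a₂ b₂ _ _ hc₂ (Real.sin_sq_add_cos_sq (c₂ * t))
    linear_combination h₁ + h₂
end

section
/- Let μ₁, μ₂ ∈ ℝ with μ₁ < μ₂ and let E ∈ ℝ with E ≥ 0. Then there exist z₀, x, y ∈ ℝ with x ≥ 0, y ≥ 0 such that x + y + z₀² = 2E, the implication (z₀ + μ₁ = 0 → x = 0) holds, the implication (z₀ + μ₂ = 0 → y = 0) holds, and z₀ + x/(2(z₀+μ₁)) + y/(2(z₀+μ₂)) = 0 (with the convention that a term with zero denominator, whose numerator is then zero, is read as 0). -/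
/-- If `2E < μ²` there is a solution using a single eigenvalue. -/
theorem single_aux (μ E : ℝ) (hE : 0 ≤ E) (h : 2 * E < μ ^ 2) :
    ∃ z x : ℝ, 0 ≤ x ∧ x + z ^ 2 = 2 * E ∧ z + μ ≠ 0 ∧ z + x / (2 * (z + μ)) = 0 := by
  have hs : 0 < √(μ ^ 2 - 2 * E) := Real.sqrt_pos.mpr (by linarith)
  have hs2 : √(μ ^ 2 - 2 * E) ^ 2 = μ ^ 2 - 2 * E := Real.sq_sqrt (by linarith)
  generalize √(μ ^ 2 - 2 * E) = s at hs hs2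
  rcases le_total 0 μ with hm | hm
  · have hle : s ≤ μ := by nlinarith
    have hne : s - μ + μ ≠ 0 := by simpa using hs.ne'
    refine ⟨s - μ, 2 * E - (s - μ) ^ 2, by nlinarith, by ring, hne, ?_⟩
    field_simp
    nlinarith
  · have hle : s ≤ -μ := by nlinarith
    have hne : -s - μ + μ ≠ 0 := by simpa using hs.ne'
    refine ⟨-s - μ, 2 * E - (-s - μ) ^ 2, by nlinarith, by ring, hne, ?_⟩
    field_simp
    nlinarith

/-- For a non-exact type I Lorentz force on `H₅` (eigenvalue parameters
`μ₁ < μ₂`) there is a periodic magnetic trajectory at every energy level `E ≥ 0`: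
there exist `z₀` and `x = ‖Ṽ₁⁰‖² ≥ 0`, `y = ‖Ṽ₂⁰‖² ≥ 0` with `x + y + z₀² = 2E`,
such that a vanishing denominator `z₀ + μ_i = 0` forces the corresponding numerator to
vanish, and the periodicity condition `z₀ + x/(2(z₀+μ₁)) + y/(2(z₀+μ₂)) = 0` holds
(in Lean division by zero is zero, implementing the stated convention). -/
theorem stmt_19
    (μ₁ μ₂ E : ℝ) (hμ : μ₁ < μ₂) (hE : 0 ≤ E) :
    ∃ z₀ x y : ℝ, 0 ≤ x ∧ 0 ≤ y ∧ x + y + z₀ ^ 2 = 2 * E ∧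
      (z₀ + μ₁ = 0 → x = 0) ∧ (z₀ + μ₂ = 0 → y = 0) ∧
      z₀ + x / (2 * (z₀ + μ₁)) + y / (2 * (z₀ + μ₂)) = 0 := by
  by_cases h1 : 2 * E < μ₁ ^ 2
  · obtain ⟨z, x, hx, he, hn, hz⟩ := single_aux μ₁ E hE h1
    exact ⟨z, x, 0, hx, le_rfl, by linarith, fun h => absurd h hn, fun _ => rfl, by simpa using hz⟩
  by_cases h2 : 2 * E < μ₂ ^ 2
  · obtain ⟨z, x, hx, he, hn, hz⟩ := single_aux μ₂ E hE h2
    exact ⟨z, 0, x, le_rfl, hx, by linarith, fun _ => rfl, fun h => absurd h hn, by simpa using hz⟩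
  obtain ⟨m, d, rfl, rfl⟩ : ∃ m d : ℝ, μ₁ = m - d ∧ μ₂ = m + d :=
    ⟨(μ₁ + μ₂) / 2, (μ₂ - μ₁) / 2, by ring, by ring⟩
  have hd : 0 < d := by linarith
  refine ⟨-m, (2 * E - m ^ 2 - 2 * d * m) / 2, (2 * E - m ^ 2 + 2 * d * m) / 2,
    by nlinarith, by nlinarith, by ring, fun h => by linarith, fun h => by linarith, ?_⟩
  have e1 : -m + (m - d) = -d := by ring
  have e2 : -m + (m + d) = d := by ring
  rw [e1, e2]
  field_simp
  ring
end
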